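/- Let d ≥ 1 and let μ be a probability distribution on the subsets of {1,…,n} with μ(S) = 0 unless |S| = d, whose generating polynomial g_μ = Σ_S μ(S)·∏_{i∈S} x_i is strongly log-concave at 𝟙. For η ⊆ {1,…,n} put w(η) = Σ_{ρ ∈ supp(μ), ρ ⊇ η} μ(ρ), and let P_μ be the real matrix indexed by supp(μ) with entries P_μ(τ,τ) = Σ_{i∈τ} μ(τ)/(d·w(τ∖{i})), P_μ(τ,σ) = μ(σ)/(d·w(τ∩σ)) when τ ≠ σ and |τ∩σ| = d−1, and 0 otherwise. Then for every τ ∈ supp(μ), every 0 < ε < 1, and every natural number t with t ≥ d·log(1/(ε·μ(τ))), the t-step distribution started at τ satisfies Σ_{σ ∈ supp(μ)} |(P_μ^t)(τ,σ) − μ(σ)| ≤ ε. -/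

import Mathlib

open MvPolynomial Matrix Finset
open scoped Classical

noncomputable section

abbrev MP (n : ℕ) := MvPolynomial (Fin n) ℝ

/-- Iterated partial derivative along a list of indices. -/
def derivList {n : ℕ} (l : List (Fin n)) (q : MP n) : MP n :=
  l.foldr (fun i r => pderiv i r) q

/-- Gradient at the all-ones point. -/
def gradOne {n : ℕ} (q : MP n) : Fin n → ℝ := fun i => eval (fun _ => (1:ℝ)) (pderiv i q)

/-- Hessian at the all-ones point. -/
def hessOne {n : ℕ} (q : MP n) : Matrix (Fin n) (Fin n) ℝ :=
  Matrix.of fun i j => eval (fun _ => (1:ℝ)) (pderiv i (pderiv j q))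

/-- `q` is log-concave at the all-ones point: `q(𝟙)·∇²q(𝟙) − ∇q(𝟙)∇q(𝟙)ᵀ` is NSD,
equivalently its negation is PSD. -/
def LogConcaveAtOne {n : ℕ} (q : MP n) : Prop :=
  (vecMulVec (gradOne q) (gradOne q) - eval (fun _ => (1:ℝ)) q • hessOne q).PosSemidef

/-- `q` is strongly log-concave at the all-ones point. -/
def StronglyLogConcaveAtOne {n : ℕ} (q : MP n) : Prop :=
  ∀ l : List (Fin n), LogConcaveAtOne (derivList l q)

/-- The generating polynomial `g_μ = Σ_S μ(S) ∏_{i∈S} x_i`. -/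
def genPoly (n : ℕ) (μ : Finset (Fin n) → ℝ) : MP n :=
  ∑ S : Finset (Fin n), C (μ S) * ∏ i ∈ S, X i

/-- `w(η) = Σ_{ρ ∈ supp μ, ρ ⊇ η} μ(ρ)`. -/
def wFun (n : ℕ) (μ : Finset (Fin n) → ℝ) (η : Finset (Fin n)) : ℝ :=
  ∑ ρ ∈ Finset.univ.filter (fun ρ : Finset (Fin n) => 0 < μ ρ ∧ η ⊆ ρ), μ ρ

/-- The support of `μ`, as a type. -/
abbrev Supp (n : ℕ) (μ : Finset (Fin n) → ℝ) := {S : Finset (Fin n) // 0 < μ S}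

/-- The transition probability matrix `P_μ` of the down-up walk `ℳ_μ`. -/
def Pmat (n d : ℕ) (μ : Finset (Fin n) → ℝ) : Matrix (Supp n μ) (Supp n μ) ℝ :=
  Matrix.of fun τ σ =>
    if τ = σ then ∑ i ∈ τ.1, μ τ.1 / (d * wFun n μ (τ.1.erase i))
    else if (τ.1 ∩ σ.1).card = d - 1 then μ σ.1 / (d * wFun n μ (τ.1 ∩ σ.1))
    else 0



/-- Weighted up-sum. -/
def FF {n : ℕ} (μ f : Finset (Fin n) → ℝ) (η : Finset (Fin n)) : ℝ :=
  ∑ ρ : Finset (Fin n), if η ⊆ ρ then μ ρ * f ρ else 0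

def WW {n : ℕ} (μ : Finset (Fin n) → ℝ) (η : Finset (Fin n)) : ℝ :=
  ∑ ρ : Finset (Fin n), if η ⊆ ρ then μ ρ else 0

lemma WW_eq_FF {n : ℕ} (μ : Finset (Fin n) → ℝ) (η : Finset (Fin n)) :
    WW μ η = FF μ (fun _ => 1) η := by simp [WW, FF]

lemma WW_eq_wFun {n : ℕ} (μ : Finset (Fin n) → ℝ) (hnn : ∀ S, 0 ≤ μ S) (η : Finset (Fin n)) :
    wFun n μ η = WW μ η := by
  unfold wFun WW
  rw [Finset.sum_filter]
  refine Finset.sum_congr rfl fun ρ _ => ?_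
  by_cases h : 0 < μ ρ
  · simp [h]
  · have : μ ρ = 0 := le_antisymm (not_lt.mp h) (hnn ρ)
    simp [this]

lemma WW_nonneg {n : ℕ} (μ : Finset (Fin n) → ℝ) (hnn : ∀ S, 0 ≤ μ S) (η : Finset (Fin n)) :
    0 ≤ WW μ η := by
  unfold WW
  refine Finset.sum_nonneg fun ρ _ => ?_
  split_ifs
  · exact hnn ρ
  · exact le_rfl

lemma FF_zero {n : ℕ} (μ f : Finset (Fin n) → ℝ) (hnn : ∀ S, 0 ≤ μ S) (η : Finset (Fin n))
    (h : WW μ η = 0) : FF μ f η = 0 := by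
  unfold WW at h
  rw [Finset.sum_eq_zero_iff_of_nonneg] at h
  · unfold FF
    refine Finset.sum_eq_zero fun ρ hρ => ?_
    have := h ρ hρ
    split_ifs at this ⊢ with h1
    · simp [this]
    · rfl
  · intro ρ _
    split_ifs
    · exact hnn ρ
    · exact le_rfl

lemma WW_mono {n : ℕ} (μ : Finset (Fin n) → ℝ) (hnn : ∀ S, 0 ≤ μ S) {η θ : Finset (Fin n)}
    (h : η ⊆ θ) : WW μ θ ≤ WW μ η := by
  unfold WW
  refine Finset.sum_le_sum fun ρ _ => ?_
  by_cases h1 : θ ⊆ ρ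
  · simp [h1, h.trans h1]
  · rw [if_neg h1]
    split_ifs
    · exact hnn ρ
    · exact le_rfl

lemma FF_step {n d : ℕ} (μ f : Finset (Fin n) → ℝ) (hhom : ∀ S, μ S ≠ 0 → S.card = d)
    (η : Finset (Fin n)) :
    ∑ i, (if i ∈ η then 0 else FF μ f (insert i η)) = ((d:ℝ) - η.card) * FF μ f η := by
  unfold FF
  have : ∀ i, (if i ∈ η then 0 else ∑ ρ : Finset (Fin n), if insert i η ⊆ ρ then μ ρ * f ρ else 0)
      = ∑ ρ : Finset (Fin n), if i ∈ ρ \ η then (if η ⊆ ρ then μ ρ * f ρ else 0) else 0 := by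
    intro i
    by_cases h : i ∈ η
    · simp [h]
    · simp only [h, if_false]
      refine Finset.sum_congr rfl fun ρ _ => ?_
      simp only [Finset.insert_subset_iff, Finset.mem_sdiff, h, not_false_eq_true, and_true]
      by_cases h1 : i ∈ ρ <;> simp [h1]
  simp_rw [this]
  rw [Finset.sum_comm, Finset.mul_sum]
  refine Finset.sum_congr rfl fun ρ _ => ?_
  rw [Finset.sum_ite_mem, Finset.univ_inter, Finset.sum_const, nsmul_eq_mul]
  split_ifs with h
  · by_cases h0 : μ ρ = 0
    · simp [h0]
    · rw [Finset.card_sdiff_of_subset h, Nat.cast_sub (Finset.card_le_card h), hhom ρ h0]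
  · simp

lemma FF_top {n d : ℕ} (μ f : Finset (Fin n) → ℝ) (hhom : ∀ S, μ S ≠ 0 → S.card = d)
    (η : Finset (Fin n)) (h : η.card = d) : FF μ f η = μ η * f η := by
  unfold FF
  rw [Finset.sum_eq_single η]
  · simp
  · intro ρ _ hne
    split_ifs with h1
    · by_cases h0 : μ ρ = 0
      · simp [h0]
      · exact absurd (Finset.eq_of_subset_of_card_le h1 (by rw [hhom ρ h0, h])).symm hne
    · rfl
  · simp

lemma double_count {n : ℕ} (k : ℕ) (H : Finset (Fin n) → Fin n → ℝ) :
    ∑ η ∈ Finset.univ.filter (fun η : Finset (Fin n) => η.card = k),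
      ∑ i, (if i ∈ η then 0 else H η i) =
    ∑ θ ∈ Finset.univ.filter (fun η : Finset (Fin n) => η.card = k + 1),
      ∑ i ∈ θ, H (θ.erase i) i := by
  have h1 : ∀ η : Finset (Fin n), ∑ i, (if i ∈ η then 0 else H η i) = ∑ i ∈ ηᶜ, H η i := by
    intro η
    rw [← Finset.sum_filter_add_sum_filter_not Finset.univ (fun i => i ∈ η)]
    rw [Finset.sum_eq_zero (s := Finset.univ.filter _), zero_add]
    · refine Finset.sum_congr ?_ ?_
      · ext; simp
      · intro i hi; simp at hi; simp [hi]
    · intro i hi; simp at hi; simp [hi]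
  simp_rw [h1]
  rw [Finset.sum_sigma', Finset.sum_sigma']
  refine Finset.sum_bij' (fun x _ => ⟨insert x.2 x.1, x.2⟩) (fun x _ => ⟨x.1.erase x.2, x.2⟩)
    ?_ ?_ ?_ ?_ ?_
  · rintro ⟨η, i⟩ h
    simp at h ⊢
    rw [Finset.card_insert_of_notMem h.2, h.1]
  · rintro ⟨η, i⟩ h
    simp at h ⊢
    rw [Finset.card_erase_of_mem h.2, h.1]; simp
  · rintro ⟨η, i⟩ h
    simp at h ⊢
    exact h.2
  · rintro ⟨η, i⟩ h
    simp at h ⊢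
    exact Finset.insert_erase h.2
  · rintro ⟨η, i⟩ h
    simp only [Finset.mem_sigma, Finset.mem_filter, Finset.mem_compl] at h
    simp only
    rw [Finset.erase_insert h.2]

def AA {n : ℕ} (k : ℕ) (H : Finset (Fin n) → ℝ) : ℝ :=
  ∑ η ∈ Finset.univ.filter (fun η : Finset (Fin n) => η.card = k), H η

def TT {n : ℕ} (H : Finset (Fin n) → ℝ) (η : Finset (Fin n)) : ℝ :=
  ∑ i, (if i ∈ η then 0 else H (insert i η))

lemma AA_TT {n : ℕ} (k : ℕ) (H : Finset (Fin n) → ℝ) : AA k (TT H) = (k + 1) * AA (k+1) H := by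
  unfold AA TT
  rw [double_count k (fun η i => H (insert i η)), Finset.mul_sum]
  refine Finset.sum_congr rfl fun θ hθ => ?_
  rw [Finset.sum_congr rfl (fun i hi => by rw [Finset.insert_erase hi])]
  simp at hθ
  simp [hθ]

lemma pderiv_prod {n : ℕ} (i : Fin n) (A : Finset (Fin n)) :
    pderiv i (∏ j ∈ A, (X j : MP n)) = if i ∈ A then ∏ j ∈ A.erase i, X j else 0 := by
  induction A using Finset.induction_on with
  | empty => simp
  | insert a A ha ih =>
    rw [Finset.prod_insert ha, Derivation.leibniz, ih, pderiv_X]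
    by_cases h : i = a
    · subst h
      simp [ha]
    · have h' : a ≠ i := fun e => h e.symm
      simp only [Finset.mem_insert, h, false_or, Pi.single_apply]
      by_cases h2 : i ∈ A
      · simp only [h2, if_true, if_neg h', mul_zero, add_zero, smul_eq_mul]
        rw [Finset.erase_insert_of_ne h', Finset.prod_insert (by simp [ha])]
      · simp [h2, h']

lemma derivList_gen {n : ℕ} (μ : Finset (Fin n) → ℝ) (l : List (Fin n)) :
    derivList l (genPoly n μ) = if l.Nodup then
      ∑ S : Finset (Fin n), if l.toFinset ⊆ S then C (μ S) * ∏ i ∈ S \ l.toFinset, X i else 0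
      else 0 := by
  induction l with
  | nil => simp [derivList, genPoly]
  | cons a l ih =>
    have : derivList (a :: l) (genPoly n μ) = pderiv a (derivList l (genPoly n μ)) := rfl
    rw [this, ih]
    by_cases hl : l.Nodup
    · by_cases ha : a ∈ l
      · simp only [hl, if_true, List.nodup_cons, ha, not_true_eq_false, false_and, if_false]
        rw [map_sum]
        refine Finset.sum_eq_zero fun S _ => ?_
        split_ifs
        · rw [pderiv_C_mul, pderiv_prod]; simp [ha]
        · simp
      · simp only [hl, if_true, List.nodup_cons, ha, not_false_eq_true, true_and]
        rw [map_sum]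
        refine Finset.sum_congr rfl fun S _ => ?_
        simp only [List.toFinset_cons, Finset.insert_subset_iff]
        by_cases hS : l.toFinset ⊆ S
        · by_cases haS : a ∈ S
          · simp only [hS, haS, if_true, and_self]
            rw [pderiv_C_mul, pderiv_prod, if_pos (by simp [ha, haS])]
            congr 2
            ext; simp; tauto
          · simp only [hS, haS, if_true, false_and, if_false]
            rw [pderiv_C_mul, pderiv_prod, if_neg (by simp [haS])]
            simp
        · simp [hS]
    · simp [hl]

lemma eval_derivList {n : ℕ} (μ : Finset (Fin n) → ℝ) (l : List (Fin n)) :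
    eval (fun _ => (1:ℝ)) (derivList l (genPoly n μ)) =
      if l.Nodup then WW μ l.toFinset else 0 := by
  rw [derivList_gen]
  split_ifs
  · rw [map_sum]
    unfold WW
    refine Finset.sum_congr rfl fun S _ => ?_
    split_ifs <;> simp
  · simp

lemma slc_ineq {n : ℕ} (μ : Finset (Fin n) → ℝ) (hslc : StronglyLogConcaveAtOne (genPoly n μ))
    (η : Finset (Fin n)) (v : Fin n → ℝ) :
    WW μ η * ∑ i, (if i ∈ η then 0 else ∑ j, (if j ∈ insert i η then 0
      else WW μ (insert j (insert i η)) * (v i * v j)))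
      ≤ (∑ i, (if i ∈ η then 0 else WW μ (insert i η) * v i)) ^ 2 := by
  have h := (hslc η.toList).dotProduct_mulVec_nonneg v
  have e0 : eval (fun _ => (1:ℝ)) (derivList η.toList (genPoly n μ)) = WW μ η := by
    rw [eval_derivList]; simp [Finset.nodup_toList]
  have e1 : ∀ i, gradOne (derivList η.toList (genPoly n μ)) i =
      if i ∈ η then 0 else WW μ (insert i η) := by
    intro i
    have : gradOne (derivList η.toList (genPoly n μ)) i =
      eval (fun _ => (1:ℝ)) (derivList (i :: η.toList) (genPoly n μ)) := rfl
    rw [this, eval_derivList]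
    by_cases h : i ∈ η <;> simp [h, Finset.nodup_toList]
  have e2 : ∀ i j, hessOne (derivList η.toList (genPoly n μ)) j i =
      if i ∈ η then 0 else if j ∈ insert i η then 0 else WW μ (insert j (insert i η)) := by
    intro i j
    have : hessOne (derivList η.toList (genPoly n μ)) j i =
      eval (fun _ => (1:ℝ)) (derivList (j :: i :: η.toList) (genPoly n μ)) := rfl
    rw [this, eval_derivList]
    by_cases h : i ∈ η
    · simp [h]
    · by_cases h2 : j ∈ insert i η
      · simp at h2
        simp [h, h2]
      · simp at h2
        simp [h, h2, Finset.nodup_toList]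
  rw [e0, Matrix.sub_mulVec, dotProduct_sub] at h
  have a1 : star v ⬝ᵥ (vecMulVec (gradOne (derivList η.toList (genPoly n μ)))
      (gradOne (derivList η.toList (genPoly n μ))) *ᵥ v) =
      (∑ i, (if i ∈ η then 0 else WW μ (insert i η) * v i)) ^ 2 := by
    simp only [dotProduct, mulVec, vecMulVec_apply, e1, star_trivial, Pi.star_apply]
    rw [sq, Finset.sum_mul_sum]
    refine Finset.sum_congr rfl fun i _ => ?_
    rw [Finset.mul_sum]
    refine Finset.sum_congr rfl fun j _ => ?_
    split_ifs <;> ring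
  have a2 : star v ⬝ᵥ ((WW μ η • hessOne (derivList η.toList (genPoly n μ))) *ᵥ v) =
      WW μ η * ∑ i, (if i ∈ η then 0 else ∑ j, (if j ∈ insert i η then 0
      else WW μ (insert j (insert i η)) * (v i * v j))) := by
    rw [Matrix.smul_mulVec, dotProduct_smul, smul_eq_mul]
    congr 1
    simp only [dotProduct, mulVec, e2, star_trivial, Pi.star_apply]
    simp_rw [Finset.mul_sum]
    rw [Finset.sum_comm]
    refine Finset.sum_congr rfl fun i _ => ?_
    split_ifs with h
    · simp
    · refine Finset.sum_congr rfl fun j _ => ?_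
      split_ifs <;> ring
  rw [a1, a2] at h
  linarith

lemma local_abs {ι : Type*} [Fintype ι] (w F m : ℝ) (w1 F1 : ι → ℝ) (w2 F2 : ι → ι → ℝ)
    (hw2 : ∀ i j, 0 ≤ w2 i j) (hw : 0 ≤ w)
    (sw : ∀ i j, w2 i j = w2 j i) (sF : ∀ i j, F2 i j = F2 j i)
    (z0 : w = 0 → F = 0) (z1 : ∀ i, w1 i = 0 → F1 i = 0) (z2 : ∀ i j, w2 i j = 0 → F2 i j = 0)
    (z : w = 0 → ∀ i j, w2 i j = 0)
    (r2 : ∀ i, ∑ j, w2 i j = (m - 1) * w1 i) (q2 : ∀ i, ∑ j, F2 i j = (m - 1) * F1 i)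
    (r1 : ∑ i, w1 i = m * w) (q1 : ∑ i, F1 i = m * F)
    (lc : ∀ v : ι → ℝ, w * ∑ i, ∑ j, w2 i j * (v i * v j) ≤ (∑ i, w1 i * v i) ^ 2) :
    0 ≤ ∑ i, ∑ j, F2 i j ^ 2 / w2 i j - 2 * (m - 1) * ∑ i, F1 i ^ 2 / w1 i
      + m * (m - 1) * (F ^ 2 / w) := by
  obtain ⟨p, hp⟩ : ∃ p : ℝ, p = F / w := ⟨_, rfl⟩
  obtain ⟨φ, hφ⟩ : ∃ φ : ι → ℝ, φ = fun i => F1 i / w1 i := ⟨_, rfl⟩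
  obtain ⟨ψ, hψ⟩ : ∃ ψ : ι → ι → ℝ, ψ = fun i j => F2 i j / w2 i j := ⟨_, rfl⟩
  have e0 : w * p = F := by
    by_cases h : w = 0
    · rw [h, z0 h]; simp
    · rw [hp]; field_simp
  have e1 : ∀ i, w1 i * φ i = F1 i := by
    intro i
    by_cases h : w1 i = 0
    · rw [h, z1 i h]; simp
    · rw [hφ]; field_simp
  have e2 : ∀ i j, w2 i j * ψ i j = F2 i j := by
    intro i j
    by_cases h : w2 i j = 0
    · rw [h, z2 i j h]; simp
    · rw [hψ]; field_simp
  have g0 : F ^ 2 / w = F * p := by rw [hp]; ring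
  have g1 : ∀ i, F1 i ^ 2 / w1 i = F1 i * φ i := by intro i; rw [hφ]; ring
  have g2 : ∀ i j, F2 i j ^ 2 / w2 i j = F2 i j * ψ i j := by intro i j; rw [hψ]; ring
  simp_rw [g0, g1, g2]
  have S1 : 0 ≤ ∑ i, ∑ j, w2 i j * (ψ i j - φ i - φ j + p) ^ 2 :=
    Finset.sum_nonneg fun i _ => Finset.sum_nonneg fun j _ => mul_nonneg (hw2 i j) (sq_nonneg _)
  have S2 : ∑ i, ∑ j, w2 i j * ((φ i - p) * (φ j - p)) ≤ 0 := by
    by_cases h : w = 0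
    · simp [z h]
    · have hpos : 0 < w := lt_of_le_of_ne hw (Ne.symm h)
      have := lc (fun i => φ i - p)
      have hz : ∑ i, w1 i * (φ i - p) = 0 := by
        simp_rw [mul_sub, e1]
        rw [Finset.sum_sub_distrib, ← Finset.sum_mul, r1, q1, ← e0]; ring
      rw [hz] at this
      by_contra hc
      push Not at hc
      have := mul_pos hpos hc
      linarith
  have key : ∑ i, ∑ j, w2 i j * (ψ i j - φ i - φ j + p) ^ 2
      - 2 * ∑ i, ∑ j, w2 i j * ((φ i - p) * (φ j - p))
      = ∑ i, ∑ j, (F2 i j * ψ i j + (w2 i j * φ i ^ 2 - 2 * F2 i j * φ i)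
        + (w2 j i * φ j ^ 2 - 2 * F2 j i * φ j) + (2 * F2 i j * p - w2 i j * p ^ 2)) := by
    rw [Finset.mul_sum, ← Finset.sum_sub_distrib]
    refine Finset.sum_congr rfl fun i _ => ?_
    rw [Finset.mul_sum, ← Finset.sum_sub_distrib]
    refine Finset.sum_congr rfl fun j _ => ?_
    rw [sF j i, sw j i, ← e2 i j]
    ring
  have row : ∑ i, ∑ j, (w2 i j * φ i ^ 2 - 2 * F2 i j * φ i)
      = - ((m - 1) * ∑ i, F1 i * φ i) := by
    rw [Finset.mul_sum, ← Finset.sum_neg_distrib]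
    refine Finset.sum_congr rfl fun i _ => ?_
    rw [Finset.sum_sub_distrib, ← Finset.sum_mul, ← Finset.sum_mul, ← Finset.mul_sum, r2, q2, ← e1]
    ring
  have row' : ∑ i, ∑ j, (w2 j i * φ j ^ 2 - 2 * F2 j i * φ j)
      = - ((m - 1) * ∑ i, F1 i * φ i) := by
    rw [Finset.sum_comm]; exact row
  have row0 : ∑ i, ∑ j, (2 * F2 i j * p - w2 i j * p ^ 2) = m * (m - 1) * (F * p) := by
    have : ∀ i, ∑ j, (2 * F2 i j * p - w2 i j * p ^ 2)
        = (m - 1) * (2 * F1 i * p - w1 i * p ^ 2) := by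
      intro i
      rw [Finset.sum_sub_distrib, ← Finset.sum_mul, ← Finset.sum_mul, ← Finset.mul_sum, r2, q2]
      ring
    simp_rw [this]
    rw [← Finset.mul_sum, Finset.sum_sub_distrib, ← Finset.sum_mul, ← Finset.sum_mul,
      ← Finset.mul_sum, r1, q1, ← e0]
    ring
  simp_rw [Finset.sum_add_distrib] at key
  rw [row, row', row0] at key
  linarith

def GG {n : ℕ} (μ f : Finset (Fin n) → ℝ) (η : Finset (Fin n)) : ℝ := FF μ f η ^ 2 / WW μ η

lemma local_ineq {n d : ℕ} (μ : Finset (Fin n) → ℝ)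
    (hnn : ∀ S, 0 ≤ μ S) (hhom : ∀ S, μ S ≠ 0 → S.card = d)
    (hslc : StronglyLogConcaveAtOne (genPoly n μ)) (f : Finset (Fin n) → ℝ)
    (η : Finset (Fin n)) (m : ℝ) (hm : m = (d : ℝ) - η.card) :
    0 ≤ TT (TT (GG μ f)) η - 2 * (m - 1) * TT (GG μ f) η + m * (m - 1) * GG μ f η := by
  have h := local_abs (WW μ η) (FF μ f η) m
    (fun i => if i ∈ η then 0 else WW μ (insert i η))
    (fun i => if i ∈ η then 0 else FF μ f (insert i η))
    (fun i j => if i ∈ η then 0 else if j ∈ insert i η then 0 else WW μ (insert j (insert i η)))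
    (fun i j => if i ∈ η then 0 else if j ∈ insert i η then 0 else FF μ f (insert j (insert i η)))
    ?_ (WW_nonneg μ hnn η) ?_ ?_ (FF_zero μ f hnn η) ?_ ?_ ?_ ?_ ?_ ?_ ?_ ?_
  · have c1 : TT (TT (GG μ f)) η = ∑ i, ∑ j,
        (if i ∈ η then 0 else if j ∈ insert i η then 0 else FF μ f (insert j (insert i η))) ^ 2 /
        (if i ∈ η then 0 else if j ∈ insert i η then 0 else WW μ (insert j (insert i η))) := by
      unfold TT GG
      refine Finset.sum_congr rfl fun i _ => ?_
      split_ifs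
      · simp
      · refine Finset.sum_congr rfl fun j _ => ?_
        split_ifs <;> simp
    have c2 : TT (GG μ f) η = ∑ i, (if i ∈ η then 0 else FF μ f (insert i η)) ^ 2 /
        (if i ∈ η then 0 else WW μ (insert i η)) := by
      unfold TT GG
      refine Finset.sum_congr rfl fun i _ => ?_
      split_ifs <;> simp
    rw [c1, c2]
    exact h
  · intro i j
    split_ifs
    · exact le_rfl
    · exact le_rfl
    · exact WW_nonneg μ hnn _
  · intro i j
    simp only [Finset.mem_insert]
    rw [Finset.insert_comm]
    split_ifs <;> first | rfl | (exfalso; grind)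
  · intro i j
    simp only [Finset.mem_insert]
    rw [Finset.insert_comm]
    split_ifs <;> first | rfl | (exfalso; grind)
  · intro i
    split_ifs
    · simp
    · exact FF_zero μ f hnn _
  · intro i j
    split_ifs
    · simp
    · simp
    · exact FF_zero μ f hnn _
  · intro h i j
    split_ifs
    · rfl
    · rfl
    · refine le_antisymm ?_ (WW_nonneg μ hnn _)
      rw [← h]
      exact WW_mono μ hnn ((Finset.subset_insert _ _).trans (Finset.subset_insert _ _))
  · intro i
    split_ifs with h
    · simp
    · have := FF_step μ (fun _ => 1) hhom (insert i η)
      simp_rw [← WW_eq_FF] at this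
      rw [this, Finset.card_insert_of_notMem h, hm]
      push_cast; ring
  · intro i
    split_ifs with h
    · simp
    · rw [FF_step μ f hhom (insert i η), Finset.card_insert_of_notMem h, hm]
      push_cast; ring
  · have := FF_step μ (fun _ => 1) hhom η
    simp_rw [← WW_eq_FF] at this
    rw [this, hm]
  · rw [FF_step μ f hhom η, hm]
  · intro v
    refine le_trans (le_of_eq ?_) ((slc_ineq μ hslc η v).trans (le_of_eq ?_))
    · congr 1
      refine Finset.sum_congr rfl fun i _ => ?_
      split_ifs
      · simp
      · refine Finset.sum_congr rfl fun j _ => ?_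
        split_ifs <;> simp
    · congr 1
      refine Finset.sum_congr rfl fun i _ => ?_
      split_ifs <;> simp

lemma AA_rec {n d : ℕ} (μ : Finset (Fin n) → ℝ)
    (hnn : ∀ S, 0 ≤ μ S) (hhom : ∀ S, μ S ≠ 0 → S.card = d)
    (hslc : StronglyLogConcaveAtOne (genPoly n μ)) (f : Finset (Fin n) → ℝ) (c : ℕ) (m : ℝ)
    (hm : m = (d : ℝ) - c) :
    0 ≤ (c + 1) * (c + 2) * AA (c + 2) (GG μ f) - 2 * (m - 1) * (c + 1) * AA (c + 1) (GG μ f)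
      + m * (m - 1) * AA c (GG μ f) := by
  have h : 0 ≤ ∑ η ∈ Finset.univ.filter (fun η : Finset (Fin n) => η.card = c),
      (TT (TT (GG μ f)) η - 2 * (m - 1) * TT (GG μ f) η + m * (m - 1) * GG μ f η) := by
    refine Finset.sum_nonneg fun η hη => ?_
    refine local_ineq μ hnn hhom hslc f η m ?_
    simp at hη
    rw [hη, hm]
  rw [Finset.sum_add_distrib, Finset.sum_sub_distrib, ← Finset.mul_sum, ← Finset.mul_sum] at h
  have t1 := AA_TT c (TT (GG μ f))
  have t2 := AA_TT (c+1) (GG μ f)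
  have t3 := AA_TT c (GG μ f)
  have e : AA c (TT (TT (GG μ f))) - 2 * (m - 1) * AA c (TT (GG μ f))
      + m * (m - 1) * AA c (GG μ f) = (c + 1) * (c + 2) * AA (c + 2) (GG μ f)
      - 2 * (m - 1) * (c + 1) * AA (c + 1) (GG μ f) + m * (m - 1) * AA c (GG μ f) := by
    rw [t1, t3, t2]; push_cast; ring
  rw [← e]
  exact h

lemma AA_gap {n d : ℕ} (μ : Finset (Fin n) → ℝ)
    (hnn : ∀ S, 0 ≤ μ S) (hhom : ∀ S, μ S ≠ 0 → S.card = d)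
    (hslc : StronglyLogConcaveAtOne (genPoly n μ)) (f : Finset (Fin n) → ℝ)
    (hf : ∑ S, μ S * f S = 0) (c : ℕ) (hc : c + 1 ≤ d) :
    ((d : ℝ) - c) * AA c (GG μ f) ≤ c * AA (c + 1) (GG μ f) := by
  induction c with
  | zero =>
    have : AA 0 (GG μ f) = 0 := by
      unfold AA
      refine Finset.sum_eq_zero fun η hη => ?_
      simp at hη
      subst hη
      unfold GG FF
      simp [hf]
    rw [this]; simp
  | succ c ih =>
    have ih := ih (by omega)
    have h := AA_rec μ hnn hhom hslc f c _ rfl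
    have hd : (0 : ℝ) ≤ (d : ℝ) - c - 1 := by
      have : ((c + 1 + 1 : ℕ) : ℝ) ≤ d := by exact_mod_cast hc
      push_cast at this; linarith
    have h2 := mul_le_mul_of_nonneg_left ih hd
    have hp : (0 : ℝ) < (c : ℝ) + 2 := by positivity
    push_cast
    refine le_of_mul_le_mul_left ?_ hp
    nlinarith

def KK {n : ℕ} (d : ℕ) (μ g : Finset (Fin n) → ℝ) (σ : Finset (Fin n)) : ℝ :=
  ∑ i ∈ σ, FF μ g (σ.erase i) / (d * WW μ (σ.erase i))

def BB {n : ℕ} (k : ℕ) (μ f g : Finset (Fin n) → ℝ) : ℝ :=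
  AA k (fun η => FF μ f η * FF μ g η / ((k + 1 : ℕ) * WW μ η))

lemma BB_comm {n : ℕ} (k : ℕ) (μ f g : Finset (Fin n) → ℝ) : BB k μ f g = BB k μ g f := by
  unfold BB; simp_rw [mul_comm (FF μ f _)]

lemma sum_card {n d : ℕ} (μ f : Finset (Fin n) → ℝ) (hhom : ∀ S, μ S ≠ 0 → S.card = d) :
    ∑ S, μ S * f S = AA d (fun S => μ S * f S) := by
  unfold AA
  rw [Finset.sum_filter]
  refine Finset.sum_congr rfl fun S _ => ?_
  split_ifs with h
  · rfl
  · have : μ S = 0 := by by_contra h0; exact h (hhom S h0)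
    simp [this]

lemma KK_form {n k : ℕ} (μ : Finset (Fin n) → ℝ) (hhom : ∀ S, μ S ≠ 0 → S.card = k + 1)
    (f g : Finset (Fin n) → ℝ) :
    ∑ S, μ S * (f S * KK (k + 1) μ g S) = BB k μ f g := by
  rw [sum_card μ (fun S => f S * KK (k + 1) μ g S) hhom]
  have h := double_count k (fun η i => μ (insert i η) * f (insert i η) *
    (FF μ g η / ((k + 1 : ℕ) * WW μ η)))
  unfold BB AA
  refine Eq.trans ?_ (h.symm.trans ?_)
  · refine Finset.sum_congr rfl fun S _ => ?_
    unfold KK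
    beta_reduce
    rw [← mul_assoc, Finset.mul_sum]
    refine Finset.sum_congr rfl fun i hi => ?_
    simp only [Finset.insert_erase hi]
  · refine Finset.sum_congr rfl fun η hη => ?_
    simp at hη
    have := FF_step μ f hhom η
    rw [hη] at this
    push_cast at this
    rw [show (k:ℝ) + 1 - k = 1 by ring, one_mul] at this
    beta_reduce
    rw [← this, mul_div_assoc, Finset.sum_mul]
    refine Finset.sum_congr rfl fun i _ => ?_
    split_ifs with h
    · simp
    · rw [FF_top μ f hhom _ (by rw [Finset.card_insert_of_notMem h, hη])]

lemma BB_gap {n k : ℕ} (μ : Finset (Fin n) → ℝ)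
    (hnn : ∀ S, 0 ≤ μ S) (hhom : ∀ S, μ S ≠ 0 → S.card = k + 1)
    (hslc : StronglyLogConcaveAtOne (genPoly n μ)) (f : Finset (Fin n) → ℝ)
    (hf : ∑ S, μ S * f S = 0) :
    BB k μ f f ≤ (1 - 1 / ((k + 1 : ℕ) : ℝ)) * ∑ S, μ S * f S ^ 2 := by
  have h := AA_gap μ hnn hhom hslc f hf k le_rfl
  have e1 : BB k μ f f = AA k (GG μ f) / (k + 1 : ℕ) := by
    unfold BB AA GG
    rw [Finset.sum_div]
    refine Finset.sum_congr rfl fun η _ => ?_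
    rw [div_div, sq, mul_comm (WW μ η)]
  have e2 : ∑ S, μ S * f S ^ 2 = AA (k + 1) (GG μ f) := by
    rw [sum_card μ (fun S => f S ^ 2) hhom]
    unfold AA GG
    refine Finset.sum_congr rfl fun η hη => ?_
    simp at hη
    rw [WW_eq_FF, FF_top μ f hhom _ hη, FF_top μ _ hhom _ hη]
    by_cases h0 : μ η = 0
    · simp [h0]
    · field_simp
  rw [e1, e2, div_le_iff₀ (by positivity)]
  push_cast at h ⊢
  have : (k:ℝ) + 1 ≠ 0 := by positivity
  have e3 : (1 - 1 / ((k:ℝ) + 1)) * AA (k + 1) (GG μ f) * (k + 1) = k * AA (k + 1) (GG μ f) := by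
    field_simp; ring
  rw [e3]
  linarith

lemma BB_cs {n k : ℕ} (μ : Finset (Fin n) → ℝ) (hnn : ∀ S, 0 ≤ μ S)
    (f g : Finset (Fin n) → ℝ) :
    BB k μ f g ^ 2 ≤ BB k μ f f * BB k μ g g := by
  unfold BB AA
  have h := Finset.sum_mul_sq_le_sq_mul_sq
    (Finset.univ.filter (fun η : Finset (Fin n) => η.card = k))
    (fun η => FF μ f η / √((k + 1 : ℕ) * WW μ η)) (fun η => FF μ g η / √((k + 1 : ℕ) * WW μ η))
  have hs : ∀ η, √((k + 1 : ℕ) * WW μ η) ^ 2 = (k + 1 : ℕ) * WW μ η := fun η =>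
    Real.sq_sqrt (mul_nonneg (by positivity) (WW_nonneg μ hnn η))
  simp_rw [div_mul_div_comm, div_pow, ← sq (√ _), hs, sq (FF _ _ _)] at h
  exact h

lemma KK_one {n d : ℕ} (hd : 1 ≤ d) (μ : Finset (Fin n) → ℝ) (hnn : ∀ S, 0 ≤ μ S)
    (hhom : ∀ S, μ S ≠ 0 → S.card = d) (σ : Finset (Fin n)) (hσ : 0 < μ σ) :
    KK d μ (fun _ => 1) σ = 1 := by
  unfold KK
  have hd' : (d : ℝ) ≠ 0 := by positivity
  have : ∀ i ∈ σ, FF μ (fun _ => 1) (σ.erase i) / (d * WW μ (σ.erase i)) = 1 / d := by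
    intro i _
    rw [← WW_eq_FF]
    have h1 := WW_mono μ hnn (Finset.erase_subset i σ)
    have h2 : WW μ σ = μ σ := by
      rw [WW_eq_FF, FF_top μ _ hhom σ (hhom σ hσ.ne')]; simp
    have : WW μ (σ.erase i) ≠ 0 := by
      have : 0 < WW μ (σ.erase i) := by linarith
      exact this.ne'
    field_simp
  rw [Finset.sum_congr rfl this, Finset.sum_const, hhom σ hσ.ne']
  simp [hd']

lemma KK_contract {n k : ℕ} (μ : Finset (Fin n) → ℝ)
    (hnn : ∀ S, 0 ≤ μ S) (hhom : ∀ S, μ S ≠ 0 → S.card = k + 1)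
    (hslc : StronglyLogConcaveAtOne (genPoly n μ)) (h : Finset (Fin n) → ℝ)
    (hh : ∑ S, μ S * h S = 0) :
    ∑ S, μ S * KK (k + 1) μ h S = 0 ∧
    ∑ S, μ S * KK (k + 1) μ h S ^ 2 ≤
      (1 - 1 / ((k + 1 : ℕ) : ℝ)) ^ 2 * ∑ S, μ S * h S ^ 2 := by
  have m0 : ∑ S, μ S * KK (k + 1) μ h S = 0 := by
    have h1 := KK_form μ hhom (fun _ => 1) h
    rw [BB_comm, ← KK_form μ hhom] at h1
    simp only [one_mul] at h1
    rw [h1, ← hh]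
    refine Finset.sum_congr rfl fun S _ => ?_
    by_cases h0 : μ S = 0
    · simp [h0]
    · rw [KK_one (by omega) μ hnn hhom S (lt_of_le_of_ne (hnn S) (Ne.symm h0)), mul_one]
  refine ⟨m0, ?_⟩
  have g1 := BB_gap μ hnn hhom hslc h hh
  have g2 := BB_gap μ hnn hhom hslc _ m0
  have cs := BB_cs (k := k) μ hnn (KK (k + 1) μ h) h
  rw [← KK_form μ hhom (KK (k + 1) μ h) h] at cs
  simp_rw [← sq] at cs
  have p1 : 0 ≤ BB k μ h h := by
    unfold BB AA
    refine Finset.sum_nonneg fun η _ => div_nonneg (mul_self_nonneg _)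
      (mul_nonneg (by positivity) (WW_nonneg μ hnn η))
  have p2 : 0 ≤ ∑ S, μ S * KK (k + 1) μ h S ^ 2 :=
    Finset.sum_nonneg fun S _ => mul_nonneg (hnn S) (sq_nonneg _)
  have hl : (0:ℝ) ≤ 1 - 1 / ((k + 1 : ℕ) : ℝ) := by
    rw [sub_nonneg, div_le_one (by positivity)]; push_cast; linarith [Nat.cast_nonneg (α := ℝ) k]
  have p3 : 0 ≤ ∑ S, μ S * h S ^ 2 :=
    Finset.sum_nonneg fun S _ => mul_nonneg (hnn S) (sq_nonneg _)
  generalize (∑ S, μ S * KK (k + 1) μ h S ^ 2) = x at *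
  generalize (∑ S, μ S * h S ^ 2) = y at *
  generalize (1 - 1 / ((k + 1 : ℕ) : ℝ)) = l at *
  rcases p2.eq_or_lt with hx | hx
  · rw [← hx]; positivity
  · have := cs.trans (mul_le_mul g2 g1 p1 (by positivity))
    refine le_of_mul_le_mul_left ?_ hx
    nlinarith

lemma Pmat_eq {n d : ℕ} (hd : 1 ≤ d) (μ : Finset (Fin n) → ℝ)
    (hnn : ∀ S, 0 ≤ μ S) (hhom : ∀ S, μ S ≠ 0 → S.card = d) (τ σ : Supp n μ) :
    Pmat n d μ τ σ = ∑ i ∈ τ.1, (if τ.1.erase i ⊆ σ.1 then μ σ.1 else 0) /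
      (d * WW μ (τ.1.erase i)) := by
  have ct := hhom _ τ.2.ne'
  have cs := hhom _ σ.2.ne'
  unfold Pmat
  simp only [Matrix.of_apply]
  split_ifs with h1 h2
  · subst h1
    refine Finset.sum_congr rfl fun i _ => ?_
    rw [WW_eq_wFun μ hnn, if_pos (Finset.erase_subset _ _)]
  · have hc : (τ.1 \ σ.1).card = 1 := by
      have := Finset.card_sdiff_add_card_inter τ.1 σ.1
      omega
    obtain ⟨a, ha⟩ := Finset.card_eq_one.mp hc
    have haτ : a ∈ τ.1 ∧ a ∉ σ.1 := by
      have : a ∈ τ.1 \ σ.1 := by rw [ha]; simp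
      simpa using this
    have he : τ.1.erase a = τ.1 ∩ σ.1 := by
      rw [← Finset.sdiff_singleton_eq_erase, ← ha]; ext; simp
    rw [Finset.sum_eq_single a]
    · rw [he, if_pos Finset.inter_subset_right, WW_eq_wFun μ hnn]
    · intro b _ hb
      rw [if_neg, zero_div]
      intro hs
      exact haτ.2 (hs (Finset.mem_erase.mpr ⟨Ne.symm hb, haτ.1⟩))
    · intro h; exact absurd haτ.1 h
  · symm
    refine Finset.sum_eq_zero fun i hi => ?_
    rw [if_neg, zero_div]
    intro hs
    have s1 : τ.1.erase i ⊆ τ.1 ∩ σ.1 := Finset.subset_inter (Finset.erase_subset _ _) hs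
    have s2 := Finset.card_le_card s1
    rw [Finset.card_erase_of_mem hi, ct] at s2
    have s3 : (τ.1 ∩ σ.1).card = d := by
      have := Finset.card_le_card (Finset.inter_subset_left (s₁ := τ.1) (s₂ := σ.1))
      omega
    have s4 : τ.1 ∩ σ.1 = τ.1 :=
      Finset.eq_of_subset_of_card_le Finset.inter_subset_left (by omega)
    have s5 : τ.1 ⊆ σ.1 := Finset.inter_eq_left.mp s4
    exact h1 (Subtype.ext (Finset.eq_of_subset_of_card_le s5 (by omega)))

lemma Pmat_rev {n d : ℕ} (μ : Finset (Fin n) → ℝ) (τ σ : Supp n μ) :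
    μ τ.1 * Pmat n d μ τ σ = μ σ.1 * Pmat n d μ σ τ := by
  by_cases h : τ = σ
  · subst h; rfl
  · unfold Pmat
    simp only [Matrix.of_apply, if_neg h, if_neg (Ne.symm h), Finset.inter_comm σ.1 τ.1]
    split_ifs
    · ring
    · ring

lemma sum_supp {n : ℕ} (μ : Finset (Fin n) → ℝ) (hnn : ∀ S, 0 ≤ μ S) (g : Finset (Fin n) → ℝ)
    (hg : ∀ S, μ S = 0 → g S = 0) : ∑ σ : Supp n μ, g σ.1 = ∑ S, g S := by
  have h1 : ∑ S, g S = ∑ S ∈ Finset.univ.filter (fun S => 0 < μ S), g S := by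
    rw [Finset.sum_filter]
    refine Finset.sum_congr rfl fun S _ => ?_
    split_ifs with h
    · rfl
    · exact hg S (le_antisymm (not_lt.mp h) (hnn S))
  rw [h1]
  exact (Finset.sum_subtype (Finset.univ.filter (fun S => 0 < μ S)) (by simp) g).symm

lemma Pmat_apply {n d : ℕ} (hd : 1 ≤ d) (μ : Finset (Fin n) → ℝ)
    (hnn : ∀ S, 0 ≤ μ S) (hhom : ∀ S, μ S ≠ 0 → S.card = d) (g : Finset (Fin n) → ℝ)
    (τ : Supp n μ) :
    ∑ σ : Supp n μ, Pmat n d μ τ σ * g σ.1 = KK d μ g τ.1 := by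
  simp_rw [Pmat_eq hd μ hnn hhom]
  rw [sum_supp μ hnn (fun S => (∑ i ∈ τ.1, (if τ.1.erase i ⊆ S then μ S else 0) /
      (d * WW μ (τ.1.erase i))) * g S) (by intro S h; simp [h])]
  simp_rw [Finset.sum_mul]
  rw [Finset.sum_comm]
  unfold KK FF
  refine Finset.sum_congr rfl fun i _ => ?_
  rw [Finset.sum_div]
  refine Finset.sum_congr rfl fun S _ => ?_
  split_ifs
  · ring
  · simp

theorem stmt1 (n d : ℕ) (hd : 1 ≤ d) (μ : Finset (Fin n) → ℝ)
    (hnn : ∀ S, 0 ≤ μ S) (hsum : ∑ S : Finset (Fin n), μ S = 1)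
    (hhom : ∀ S, μ S ≠ 0 → S.card = d)
    (hslc : StronglyLogConcaveAtOne (genPoly n μ))
    (τ : Supp n μ) (ε : ℝ) (hε0 : 0 < ε) (hε1 : ε < 1)
    (t : ℕ) (ht : (d : ℝ) * Real.log (1 / (ε * μ τ.1)) ≤ t) :
    ∑ σ : Supp n μ, |(Pmat n d μ ^ t) τ σ - μ σ.1| ≤ ε := by
  obtain ⟨k, rfl⟩ : ∃ k, d = k + 1 := ⟨d - 1, by omega⟩
  have hτ := τ.2
  obtain ⟨h0, hh0⟩ : ∃ h0 : Finset (Fin n) → ℝ,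
      h0 = fun S => (if S = τ.1 then 1 / μ τ.1 else 0) - 1 := ⟨_, rfl⟩
  obtain ⟨l, hl⟩ : ∃ l : ℝ, l = 1 - 1 / ((k + 1 : ℕ) : ℝ) := ⟨_, rfl⟩
  have hl0 : 0 ≤ l := by
    rw [hl, sub_nonneg, div_le_one (by positivity)]; push_cast
    linarith [Nat.cast_nonneg (α := ℝ) k]
  have main : ∀ s : ℕ, (∑ S, μ S * ((KK (k + 1) μ)^[s] h0) S = 0 ∧
      ∑ S, μ S * ((KK (k + 1) μ)^[s] h0) S ^ 2 ≤ (l ^ s) ^ 2 * (1 / μ τ.1)) ∧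
      ∀ σ : Supp n μ, (Pmat n (k + 1) μ ^ s) τ σ - μ σ.1
        = μ σ.1 * ((KK (k + 1) μ)^[s] h0) σ.1 := by
    intro s
    induction s with
    | zero =>
      refine ⟨⟨?_, ?_⟩, ?_⟩
      · simp only [Function.iterate_zero, id, hh0, mul_sub, mul_ite, mul_zero, mul_one]
        rw [Finset.sum_sub_distrib, hsum, Finset.sum_ite_eq' Finset.univ τ.1]
        simp [hτ.ne']
      · simp only [Function.iterate_zero, id, hh0, pow_zero, one_pow, one_mul]
        have : ∀ S, μ S * ((if S = τ.1 then 1 / μ τ.1 else 0) - 1) ^ 2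
            = (if S = τ.1 then 1 / μ τ.1 - 2 else 0) + μ S := by
          intro S
          split_ifs with h
          · rw [h]; field_simp; ring
          · ring
        simp_rw [this]
        rw [Finset.sum_add_distrib, hsum, Finset.sum_ite_eq' Finset.univ τ.1]
        simp
        linarith
      · intro σ
        simp only [Function.iterate_zero, id, hh0, pow_zero, Matrix.one_apply]
        by_cases h : τ = σ
        · subst h
          have := hτ.ne'
          simp; field_simp
        · have h' : ¬ σ.1 = τ.1 := fun e => h (Subtype.ext e.symm)
          simp [h, h']
    | succ s ih =>
      obtain ⟨⟨i1, i2⟩, i3⟩ := ih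
      rw [Function.iterate_succ_apply']
      generalize (KK (k + 1) μ)^[s] h0 = h at *
      obtain ⟨c1, c2⟩ := KK_contract μ hnn hhom hslc h i1
      refine ⟨⟨c1, ?_⟩, ?_⟩
      · refine c2.trans ?_
        rw [← hl]
        calc l ^ 2 * ∑ S, μ S * h S ^ 2 ≤ l ^ 2 * ((l ^ s) ^ 2 * (1 / μ τ.1)) := by gcongr
          _ = _ := by ring
      · intro σ
        rw [pow_succ, Matrix.mul_apply]
        have e : ∀ ρ : Supp n μ, (Pmat n (k + 1) μ ^ s) τ ρ * Pmat n (k + 1) μ ρ σ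
            = μ σ.1 * (Pmat n (k + 1) μ σ ρ * (fun _ => (1:ℝ)) ρ.1)
              + μ σ.1 * (Pmat n (k + 1) μ σ ρ * h ρ.1) := by
          intro ρ
          have r := Pmat_rev (d := k + 1) μ ρ σ
          have : (Pmat n (k + 1) μ ^ s) τ ρ = μ ρ.1 * (1 + h ρ.1) := by
            linarith [i3 ρ]
          rw [this]
          simp only
          linear_combination (1 + h ρ.1) * r
        simp_rw [e]
        rw [Finset.sum_add_distrib, ← Finset.mul_sum, ← Finset.mul_sum,
          Pmat_apply hd μ hnn hhom (fun _ => (1:ℝ)), Pmat_apply hd μ hnn hhom,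
          KK_one hd μ hnn hhom _ σ.2]
        ring
  obtain ⟨⟨-, m2⟩, m3⟩ := main t
  simp_rw [m3]
  generalize (KK (k + 1) μ)^[t] h0 = h at *
  simp_rw [abs_mul, fun σ : Supp n μ => abs_of_nonneg (hnn σ.1)]
  rw [sum_supp μ hnn (fun S => μ S * |h S|) (by intro S h; simp [h])]
  have cs : (∑ S, μ S * |h S|) ^ 2 ≤ (∑ S, μ S) * ∑ S, μ S * h S ^ 2 := by
    refine Finset.sum_sq_le_sum_mul_sum_of_sq_le_mul _ (fun S _ => hnn S)
      (fun S _ => mul_nonneg (hnn S) (sq_nonneg _)) ?_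
    intro S _
    rw [mul_pow, sq_abs]; exact le_of_eq (by ring)
  rw [hsum, one_mul] at cs
  have hlt : l ^ t ≤ ε * μ τ.1 := by
    have a1 : l ≤ Real.exp (-(1 / ((k + 1 : ℕ) : ℝ))) := by
      rw [hl]; linarith [Real.add_one_le_exp (-(1 / ((k + 1 : ℕ) : ℝ)))]
    have a2 : l ^ t ≤ Real.exp (-(1 / ((k + 1 : ℕ) : ℝ))) ^ t := pow_le_pow_left₀ hl0 a1 t
    refine a2.trans ?_
    rw [← Real.exp_nat_mul, ← Real.le_log_iff_exp_le (by positivity)]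
    rw [one_div, Real.log_inv] at ht
    have hk : (0:ℝ) < ((k + 1 : ℕ) : ℝ) := by positivity
    have : -Real.log (ε * μ τ.1) ≤ t / ((k + 1 : ℕ) : ℝ) := by
      rw [le_div_iff₀ hk]; linarith
    have e : (t:ℝ) * -(1 / ((k + 1 : ℕ) : ℝ)) = - (t / ((k + 1 : ℕ) : ℝ)) := by ring
    rw [e]; linarith
  have hμ1 : μ τ.1 ≤ 1 := by
    rw [← hsum]; exact Finset.single_le_sum (fun S _ => hnn S) (Finset.mem_univ _)
  refine abs_le_of_sq_le_sq' ?_ hε0.le |>.2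
  refine cs.trans (m2.trans ?_)
  calc (l ^ t) ^ 2 * (1 / μ τ.1) ≤ (ε * μ τ.1) ^ 2 * (1 / μ τ.1) := by gcongr
    _ = ε ^ 2 * μ τ.1 := by field_simp
    _ ≤ ε ^ 2 * 1 := by gcongr
    _ = ε ^ 2 := mul_one _

end
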